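/- arXiv:1302.3303 — 3 statements merged into one kernel-verified Lean document; each statement's English description precedes it below -/
import Mathlib

section
/- Let n ≥ 2, U ⊆ ℝⁿ open, and let α, β be as in the singular (α,β)-metric setup, with b² := Σ_i b^i b_i > 0 on U. Suppose that on U: (1) r_{ij} = μ·a_{ij} for some smooth function μ : U → ℝ; (2) s_{ij} = (b_i s_j − b_j s_i)/b²; and (3) G^i_α = ρ₀·y^i − (μ·α²/(2b²))·b^i − (α²/(2b²))·s^i for all y, where ρ₀ := Σ_j ((μ·b_j + s_j)/b²)·y^j and s^i := Σ_j a^{ij} s_j. Define ã_{ij} := a_{ij}/b² and b̃_i := b_i/b². Then the covariant derivative of b̃ with respect to ã vanishes identically on U, and the spray coefficients of ã vanish identically on U (in particular ã is a flat Riemannian metric and b̃ is parallel with respect to ã). -/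
noncomputable section

open Real Finset

/-- Partial derivative of `f` at `x` in the `k`-th coordinate direction. -/
def pd {n : ℕ} (f : (Fin n → ℝ) → ℝ) (x : Fin n → ℝ) (k : Fin n) : ℝ :=
  fderiv ℝ f x (Pi.single k 1)

/-- `α(x,y) = √(Σ_{i,j} a_{ij}(x) yⁱ yʲ)`. -/
def alphaFn {n : ℕ} (a : (Fin n → ℝ) → Matrix (Fin n) (Fin n) ℝ) (x y : Fin n → ℝ) : ℝ :=
  Real.sqrt (∑ i, ∑ j, a x i j * y i * y j)

/-- `β(x,y) = Σ_i b_i(x) yⁱ`. -/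
def betaFn {n : ℕ} (b : (Fin n → ℝ) → Fin n → ℝ) (x y : Fin n → ℝ) : ℝ :=
  ∑ i, b x i * y i

/-- `‖β‖_α(x) = √(Σ_{i,j} aⁱʲ(x) b_i(x) b_j(x))`. -/
def normBeta {n : ℕ} (a : (Fin n → ℝ) → Matrix (Fin n) (Fin n) ℝ)
    (b : (Fin n → ℝ) → Fin n → ℝ) (x : Fin n → ℝ) : ℝ :=
  Real.sqrt (∑ i, ∑ j, (a x)⁻¹ i j * b x i * b x j)

/-- `D = {(x,y) : x ∈ U, y ≠ 0, β(x,y) > 0}`. -/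
def Dom {n : ℕ} (U : Set (Fin n → ℝ)) (b : (Fin n → ℝ) → Fin n → ℝ) :
    Set ((Fin n → ℝ) × (Fin n → ℝ)) :=
  {p | p.1 ∈ U ∧ p.2 ≠ 0 ∧ 0 < betaFn b p.1 p.2}

/-- Hamel's equations: `Σ_k yᵏ ∂²F/∂xᵏ∂yˡ = ∂F/∂xˡ` on `D`, for every `l`. -/
def HamelProjFlat {n : ℕ} (U : Set (Fin n → ℝ)) (b : (Fin n → ℝ) → Fin n → ℝ)
    (F : (Fin n → ℝ) → (Fin n → ℝ) → ℝ) : Prop :=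
  ∀ p ∈ Dom U b, ∀ l : Fin n,
    ∑ k, p.2 k * pd (fun y' => pd (fun x' => F x' y') p.1 k) p.2 l
      = pd (fun x' => F x' p.2) p.1 l

/-- The projective factor `P = (Σ_k yᵏ ∂F/∂xᵏ)/(2F)`. -/
def projFactor {n : ℕ} (F : (Fin n → ℝ) → (Fin n → ℝ) → ℝ) (x y : Fin n → ℝ) : ℝ :=
  (∑ k, y k * pd (fun x' => F x' y) x k) / (2 * F x y)

/-- Constant flag curvature `K`: `P² − Σ_k yᵏ ∂P/∂xᵏ = K·F²` on `D`. -/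
def ConstFlagCurv {n : ℕ} (U : Set (Fin n → ℝ)) (b : (Fin n → ℝ) → Fin n → ℝ)
    (F : (Fin n → ℝ) → (Fin n → ℝ) → ℝ) (K : ℝ) : Prop :=
  ∀ p ∈ Dom U b,
    (projFactor F p.1 p.2) ^ 2
      - ∑ k, p.2 k * pd (fun x' => projFactor F x' p.2) p.1 k
      = K * (F p.1 p.2) ^ 2

/-- Christoffel symbols `Γˡ_{jk}` of the Riemannian metric `a`. -/
def christoffel {n : ℕ} (a : (Fin n → ℝ) → Matrix (Fin n) (Fin n) ℝ)
    (x : Fin n → ℝ) (l j k : Fin n) : ℝ :=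
  (1 / 2) * ∑ i, (a x)⁻¹ l i *
    (pd (fun x' => a x' j i) x k + pd (fun x' => a x' k i) x j
      - pd (fun x' => a x' j k) x i)

/-- Covariant derivative `b_{i|j}` of the 1-form `b` with respect to `a`. -/
def covDeriv {n : ℕ} (a : (Fin n → ℝ) → Matrix (Fin n) (Fin n) ℝ)
    (b : (Fin n → ℝ) → Fin n → ℝ) (x : Fin n → ℝ) (i j : Fin n) : ℝ :=
  pd (fun x' => b x' i) x j - ∑ l, b x l * christoffel a x l i j

/-- Spray coefficients `Gⁱ_α = ½ Σ_{j,k} Γⁱ_{jk} yʲ yᵏ` of `α`. -/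
def spray {n : ℕ} (a : (Fin n → ℝ) → Matrix (Fin n) (Fin n) ℝ)
    (x y : Fin n → ℝ) (i : Fin n) : ℝ :=
  (1 / 2) * ∑ j, ∑ k, christoffel a x i j k * y j * y k

/-- `r_{ij} = ½(b_{i|j} + b_{j|i})`. -/
def rTensor {n : ℕ} (a : (Fin n → ℝ) → Matrix (Fin n) (Fin n) ℝ)
    (b : (Fin n → ℝ) → Fin n → ℝ) (x : Fin n → ℝ) (i j : Fin n) : ℝ :=
  (covDeriv a b x i j + covDeriv a b x j i) / 2

/-- `s_{ij} = ½(b_{i|j} − b_{j|i})`. -/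
def sTensor {n : ℕ} (a : (Fin n → ℝ) → Matrix (Fin n) (Fin n) ℝ)
    (b : (Fin n → ℝ) → Fin n → ℝ) (x : Fin n → ℝ) (i j : Fin n) : ℝ :=
  (covDeriv a b x i j - covDeriv a b x j i) / 2

/-- `bⁱ = Σ_j aⁱʲ b_j`. -/
def bUp {n : ℕ} (a : (Fin n → ℝ) → Matrix (Fin n) (Fin n) ℝ)
    (b : (Fin n → ℝ) → Fin n → ℝ) (x : Fin n → ℝ) (i : Fin n) : ℝ :=
  ∑ j, (a x)⁻¹ i j * b x j

/-- `s_j = Σ_i bⁱ s_{ij}`. -/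
def sLow {n : ℕ} (a : (Fin n → ℝ) → Matrix (Fin n) (Fin n) ℝ)
    (b : (Fin n → ℝ) → Fin n → ℝ) (x : Fin n → ℝ) (j : Fin n) : ℝ :=
  ∑ i, bUp a b x i * sTensor a b x i j

/-- `sⁱ = Σ_j aⁱʲ s_j`. -/
def sUp {n : ℕ} (a : (Fin n → ℝ) → Matrix (Fin n) (Fin n) ℝ)
    (b : (Fin n → ℝ) → Fin n → ℝ) (x : Fin n → ℝ) (i : Fin n) : ℝ :=
  ∑ j, (a x)⁻¹ i j * sLow a b x j

lemma pd_congr {n : ℕ} {f g : (Fin n → ℝ) → ℝ} {x : Fin n → ℝ} (h : f =ᶠ[nhds x] g)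
    (k : Fin n) : pd f x k = pd g x k := by
  unfold pd
  rw [h.fderiv_eq]

lemma pd_const {n : ℕ} (c : ℝ) (x : Fin n → ℝ) (k : Fin n) : pd (fun _ => c) x k = 0 := by
  simp [pd]

lemma pd_mul {n : ℕ} {f g : (Fin n → ℝ) → ℝ} {x : Fin n → ℝ}
    (hf : DifferentiableAt ℝ f x) (hg : DifferentiableAt ℝ g x) (k : Fin n) :
    pd (fun z => f z * g z) x k = f x * pd g x k + pd f x k * g x := by
  unfold pd
  rw [fderiv_fun_mul hf hg]
  simp [mul_comm]

lemma pd_sum {n : ℕ} {ι : Type*} (s : Finset ι) {f : ι → (Fin n → ℝ) → ℝ} {x : Fin n → ℝ}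
    (hf : ∀ i ∈ s, DifferentiableAt ℝ (f i) x) (k : Fin n) :
    pd (fun z => ∑ i ∈ s, f i z) x k = ∑ i ∈ s, pd (f i) x k := by
  unfold pd
  rw [fderiv_fun_sum hf]
  simp

/-- If `f` and `g` have the same logarithmic derivative, then `f / g` is stationary. -/
lemma pd_div_eq_zero {n : ℕ} {f g : (Fin n → ℝ) → ℝ} {x : Fin n → ℝ} {k : Fin n} {c : ℝ}
    (hf : DifferentiableAt ℝ f x) (hg : DifferentiableAt ℝ g x) (hgx : g x ≠ 0)
    (hfk : pd f x k = c * f x) (hgk : pd g x k = c * g x) :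
    pd (fun z => f z / g z) x k = 0 := by
  have hq : DifferentiableAt ℝ (fun z => f z / g z) x := by
    simpa only [div_eq_mul_inv] using hf.fun_mul (hg.fun_inv hgx)
  have hev : (fun z => f z / g z * g z) =ᶠ[nhds x] f := by
    filter_upwards [hg.continuousAt.eventually_ne hgx] with z hz
    exact div_mul_cancel₀ _ hz
  have h := pd_congr hev k
  rw [pd_mul hq hg, hfk, hgk] at h
  have h' : pd (fun z => f z / g z) x k * g x = 0 := by
    field_simp at h
    linarith
  exact (mul_eq_zero.mp h').resolve_right hgx

lemma differentiableAt_det {n : ℕ} {a : (Fin n → ℝ) → Matrix (Fin n) (Fin n) ℝ}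
    {x : Fin n → ℝ} (ha : ∀ i j, DifferentiableAt ℝ (fun z => a z i j) x) :
    DifferentiableAt ℝ (fun z => (a z).det) x := by
  simp only [Matrix.det_apply']
  refine DifferentiableAt.fun_sum fun σ _ => DifferentiableAt.const_mul ?_ _
  exact (HasFDerivAt.finsetProd fun i _ => (ha (σ i) i).hasFDerivAt).differentiableAt

lemma differentiableAt_inv_apply {n : ℕ} {a : (Fin n → ℝ) → Matrix (Fin n) (Fin n) ℝ}
    {x : Fin n → ℝ} (ha : ∀ i j, DifferentiableAt ℝ (fun z => a z i j) x)
    (hdet : (a x).det ≠ 0) (i j : Fin n) : DifferentiableAt ℝ (fun z => (a z)⁻¹ i j) x := by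
  simp only [Matrix.inv_def, Ring.inverse_eq_inv', Matrix.smul_apply, smul_eq_mul,
    Matrix.adjugate_apply]
  refine ((differentiableAt_det ha).fun_inv hdet).fun_mul (differentiableAt_det fun k l => ?_)
  by_cases hk : k = j
  · subst hk
    simp
  · simpa [Matrix.updateRow_ne hk] using ha k l

lemma sum_mul_inv_mul {n : ℕ} {A : Matrix (Fin n) (Fin n) ℝ} (hA : A.det ≠ 0)
    (v : Fin n → ℝ) (i : Fin n) : ∑ l, A i l * ∑ j, A⁻¹ l j * v j = v i := by
  have h : A.mulVec (A⁻¹.mulVec v) = v := by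
    rw [Matrix.mulVec_mulVec, Matrix.mul_nonsing_inv _ (isUnit_iff_ne_zero.mpr hA),
      Matrix.one_mulVec]
  exact congrFun h i

lemma sum_mul_christoffel {n : ℕ} {a : (Fin n → ℝ) → Matrix (Fin n) (Fin n) ℝ}
    {x : Fin n → ℝ} (hdet : (a x).det ≠ 0) (i j k : Fin n) :
    ∑ l, a x i l * christoffel a x l j k
      = (pd (fun z => a z j i) x k + pd (fun z => a z k i) x j
        - pd (fun z => a z j k) x i) / 2 := by
  rw [← sum_mul_inv_mul hdet (fun i => (pd (fun z => a z j i) x k + pd (fun z => a z k i) x j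
        - pd (fun z => a z j k) x i) / 2) i]
  refine sum_congr rfl fun l _ => ?_
  unfold christoffel
  rw [mul_sum]
  congr 1
  exact sum_congr rfl fun m _ => by ring

/-- Metric compatibility of the Levi-Civita connection. -/
lemma pd_metric_eq {n : ℕ} {a : (Fin n → ℝ) → Matrix (Fin n) (Fin n) ℝ} {x : Fin n → ℝ}
    (hdet : (a x).det ≠ 0) (hsymm : ∀ᶠ z in nhds x, (a z).IsSymm) (i j k : Fin n) :
    pd (fun z => a z i j) x k
      = ∑ l, a x i l * christoffel a x l j k + ∑ l, a x j l * christoffel a x l i k := by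
  have hs : ∀ i j k, pd (fun z => a z i j) x k = pd (fun z => a z j i) x k := fun i j k =>
    pd_congr (hsymm.mono fun z hz => hz.apply j i) k
  rw [sum_mul_christoffel hdet, sum_mul_christoffel hdet, hs j i k, hs k i j, hs k j i]
  ring

lemma christoffel_symm {n : ℕ} {a : (Fin n → ℝ) → Matrix (Fin n) (Fin n) ℝ} {x : Fin n → ℝ}
    (hsymm : ∀ᶠ z in nhds x, (a z).IsSymm) (i j k : Fin n) :
    christoffel a x i j k = christoffel a x i k j := by
  unfold christoffel
  congr 1
  refine sum_congr rfl fun m _ => ?_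
  rw [pd_congr (hsymm.mono fun z hz => hz.apply k j : (fun z => a z j k) =ᶠ[nhds x] _) m]
  ring

/-- A metric all of whose logarithmic derivatives equal `c` has inverse scaling with `-c`. -/
lemma pd_inv_apply {n : ℕ} {a : (Fin n → ℝ) → Matrix (Fin n) (Fin n) ℝ} {x : Fin n → ℝ}
    (ha : ∀ i j, DifferentiableAt ℝ (fun z => a z i j) x) (hdet : (a x).det ≠ 0)
    {k : Fin n} {c : ℝ} (hc : ∀ i j, pd (fun z => a z i j) x k = c * a x i j) (i j : Fin n) :
    pd (fun z => (a z)⁻¹ i j) x k = -c * (a x)⁻¹ i j := by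
  have hinv := differentiableAt_inv_apply ha hdet
  have key : ∀ m, ∑ l, a x m l * pd (fun z => (a z)⁻¹ l j) x k
      = -c * (1 : Matrix (Fin n) (Fin n) ℝ) m j := by
    intro m
    have hone : (fun z => ∑ l, a z m l * (a z)⁻¹ l j) =ᶠ[nhds x]
        fun _ => (1 : Matrix (Fin n) (Fin n) ℝ) m j := by
      filter_upwards [(differentiableAt_det ha).continuousAt.eventually_ne hdet] with z hz
      rw [← Matrix.mul_apply, Matrix.mul_nonsing_inv _ (isUnit_iff_ne_zero.mpr hz)]
    have h := pd_congr hone k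
    rw [pd_const, pd_sum _ (fun l _ => (ha m l).fun_mul (hinv l j))] at h
    simp only [pd_mul (ha _ _) (hinv _ _), hc, sum_add_distrib] at h
    have h1 := hone.eq_of_nhds
    simp only [mul_assoc, ← mul_sum] at h h1
    rw [h1] at h
    linarith
  have hM : (a x).mulVec (fun l => pd (fun z => (a z)⁻¹ l j) x k)
      = fun m => -c * (1 : Matrix (Fin n) (Fin n) ℝ) m j := funext key
  have h2 := congrArg (a x)⁻¹.mulVec hM
  rw [Matrix.mulVec_mulVec, Matrix.nonsing_inv_mul _ (isUnit_iff_ne_zero.mpr hdet),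
    Matrix.one_mulVec] at h2
  rw [congrFun h2 i]
  simp [Matrix.mulVec, dotProduct, Matrix.one_apply, mul_comm]

/-- A symmetric bilinear form is determined by its quadratic form. -/
lemma eq_of_quadratic_eq {n : ℕ} {M N : Fin n → Fin n → ℝ} (hM : ∀ j k, M j k = M k j)
    (hN : ∀ j k, N j k = N k j)
    (h : ∀ y : Fin n → ℝ, ∑ j, ∑ k, M j k * y j * y k = ∑ j, ∑ k, N j k * y j * y k)
    (j k : Fin n) : M j k = N j k := by
  have single : ∀ j, M j j = N j j := by
    intro j
    simpa [Pi.single_apply] using h (Pi.single j 1)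
  have hjk := h (Pi.single j 1 + Pi.single k 1)
  simp only [Pi.add_apply, Pi.single_apply, mul_add, add_mul, sum_add_distrib] at hjk
  simp at hjk
  linarith [single j, single k, hM j k, hN j k]

lemma pd_normSq {n : ℕ} {a : (Fin n → ℝ) → Matrix (Fin n) (Fin n) ℝ}
    {b : (Fin n → ℝ) → Fin n → ℝ} {x : Fin n → ℝ}
    (ha : ∀ i j, DifferentiableAt ℝ (fun z => a z i j) x) (hdet : (a x).det ≠ 0)
    (hb : ∀ i, DifferentiableAt ℝ (fun z => b z i) x) {k : Fin n} {c : ℝ}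
    (hac : ∀ i j, pd (fun z => a z i j) x k = c * a x i j)
    (hbc : ∀ i, pd (fun z => b z i) x k = c * b x i) :
    pd (fun z => ∑ i, bUp a b z i * b z i) x k = c * ∑ i, bUp a b x i * b x i := by
  have hinv := differentiableAt_inv_apply ha hdet
  have hterm : ∀ i j, DifferentiableAt ℝ (fun z => (a z)⁻¹ i j * b z j) x := fun i j =>
    (hinv i j).fun_mul (hb j)
  have hup : ∀ i, DifferentiableAt ℝ (fun z => bUp a b z i) x := fun i =>
    DifferentiableAt.fun_sum fun j _ => hterm i j
  have hup_pd : ∀ i, pd (fun z => bUp a b z i) x k = 0 := by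
    intro i
    unfold bUp
    rw [pd_sum _ fun j _ => hterm i j]
    refine sum_eq_zero fun j _ => ?_
    rw [pd_mul (hinv i j) (hb j), pd_inv_apply ha hdet hac, hbc]
    ring
  rw [pd_sum _ fun i _ => (hup i).fun_mul (hb i), mul_sum]
  refine sum_congr rfl fun i _ => ?_
  rw [pd_mul (hup i) (hb i), hup_pd, hbc]
  ring

lemma differentiableAt_normSq {n : ℕ} {a : (Fin n → ℝ) → Matrix (Fin n) (Fin n) ℝ}
    {b : (Fin n → ℝ) → Fin n → ℝ} {x : Fin n → ℝ}
    (ha : ∀ i j, DifferentiableAt ℝ (fun z => a z i j) x) (hdet : (a x).det ≠ 0)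
    (hb : ∀ i, DifferentiableAt ℝ (fun z => b z i) x) :
    DifferentiableAt ℝ (fun z => ∑ i, bUp a b z i * b z i) x :=
  DifferentiableAt.fun_sum fun i _ => (DifferentiableAt.fun_sum fun j _ =>
    (differentiableAt_inv_apply ha hdet i j).fun_mul (hb j)).fun_mul (hb i)

/-- `bⁱ s_i = 0`, by skew-symmetry of `s_{ij}`. -/
lemma sum_bUp_mul_sLow {n : ℕ} (a : (Fin n → ℝ) → Matrix (Fin n) (Fin n) ℝ)
    (b : (Fin n → ℝ) → Fin n → ℝ) (x : Fin n → ℝ) :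
    ∑ j, bUp a b x j * sLow a b x j = 0 := by
  have h : ∑ j, bUp a b x j * sLow a b x j = -∑ j, bUp a b x j * sLow a b x j := by
    unfold sLow
    simp only [mul_sum]
    conv_lhs => rw [sum_comm]
    simp only [← sum_neg_distrib]
    refine sum_congr rfl fun i _ => sum_congr rfl fun j _ => ?_
    unfold sTensor
    ring
  linarith

lemma christoffel_eq_of_spray_eq {n : ℕ} {a : (Fin n → ℝ) → Matrix (Fin n) (Fin n) ℝ}
    {x : Fin n → ℝ} (hsymm : ∀ᶠ z in nhds x, (a z).IsSymm) {p P : Fin n → ℝ}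
    (h : ∀ y : Fin n → ℝ, ∀ i, spray a x y i
      = (∑ j, p j * y j) * y i - (∑ j, ∑ k, a x j k * y j * y k) * P i / 2) (i j k : Fin n) :
    christoffel a x i j k
      = p j * (if i = k then 1 else 0) + p k * (if i = j then 1 else 0) - a x j k * P i := by
  refine eq_of_quadratic_eq (M := fun j k => christoffel a x i j k)
    (N := fun j k => p j * (if i = k then 1 else 0) + p k * (if i = j then 1 else 0)
      - a x j k * P i) (fun j k => christoffel_symm hsymm i j k) (fun j k => ?_) (fun y => ?_) j k
  · rw [hsymm.self_of_nhds.apply k j]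
    ring
  · have hy := h y i
    unfold spray at hy
    have e : ∑ j, ∑ k, (p j * (if i = k then 1 else 0) + p k * (if i = j then 1 else 0)
        - a x j k * P i) * y j * y k
        = (∑ j, p j * y j) * y i + (∑ j, p j * y j) * y i
          - (∑ j, ∑ k, a x j k * y j * y k) * P i := by
      simp only [sub_mul, add_mul, sum_sub_distrib, sum_add_distrib, sum_mul]
      congr 1
      · congr 1
        · refine sum_congr rfl fun j _ => ?_
          simp
        · rw [sum_comm]
          refine sum_congr rfl fun j _ => ?_
          simp
          ring
      · exact sum_congr rfl fun j _ => sum_congr rfl fun k _ => by ring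
    simp only [e]
    linarith

/-- Under the structure equations, every `a_{ij}` and every `b_i` has logarithmic derivative
`2 (μ b_k + s_k) / b²`. -/
lemma pd_of_structure_eq {n : ℕ} {a : (Fin n → ℝ) → Matrix (Fin n) (Fin n) ℝ}
    {b : (Fin n → ℝ) → Fin n → ℝ} {x : Fin n → ℝ} (hdet : (a x).det ≠ 0)
    (hsymm : ∀ᶠ z in nhds x, (a z).IsSymm) (hpos : (a x).PosSemidef) {B m : ℝ}
    (hB : B = ∑ i, bUp a b x i * b x i) (hB0 : B ≠ 0)
    (hr : ∀ i j, rTensor a b x i j = m * a x i j)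
    (hs : ∀ i j, sTensor a b x i j = (b x i * sLow a b x j - b x j * sLow a b x i) / B)
    (hG : ∀ y : Fin n → ℝ, ∀ i, spray a x y i
      = (∑ j, ((m * b x j + sLow a b x j) / B) * y j) * y i
        - (m * (alphaFn a x y) ^ 2 / (2 * B)) * bUp a b x i
        - ((alphaFn a x y) ^ 2 / (2 * B)) * sUp a b x i) (k : Fin n) :
    (∀ i j, pd (fun z => a z i j) x k = 2 * ((m * b x k + sLow a b x k) / B) * a x i j) ∧
    (∀ i, pd (fun z => b z i) x k = 2 * ((m * b x k + sLow a b x k) / B) * b x i) := by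
  have hax : ∀ i j, a x i j = a x j i := fun i j => hsymm.self_of_nhds.apply j i
  have halpha : ∀ y : Fin n → ℝ, (alphaFn a x y) ^ 2 = ∑ j, ∑ k, a x j k * y j * y k := by
    intro y
    refine Real.sq_sqrt ?_
    have h := hpos.dotProduct_mulVec_nonneg y
    simp only [Matrix.mulVec, dotProduct, mul_sum, star_trivial] at h
    refine h.trans_eq (sum_congr rfl fun j _ => sum_congr rfl fun k _ => by ring)
  set p : Fin n → ℝ := fun j => (m * b x j + sLow a b x j) / B with hp
  set P : Fin n → ℝ := fun i => (m * bUp a b x i + sUp a b x i) / B with hP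
  have hΓ := christoffel_eq_of_spray_eq hsymm (p := p) (P := P) fun y i => by
    rw [hG, halpha]
    change (∑ j, p j * y j) * y i - _ - _ = _
    simp only [hP]
    field_simp
    ring
  have haP : ∀ i, ∑ l, a x i l * P l = p i := by
    intro i
    have h1 : ∑ l, a x i l * bUp a b x l = b x i := sum_mul_inv_mul hdet _ i
    have h2 : ∑ l, a x i l * sUp a b x l = sLow a b x i := sum_mul_inv_mul hdet _ i
    simp only [hp]
    rw [← h1, ← h2, mul_sum, ← sum_add_distrib, sum_div]
    exact sum_congr rfl fun l _ => by simp only [hP]; ring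
  have haΓ : ∀ i j k, ∑ l, a x i l * christoffel a x l j k
      = p j * a x i k + p k * a x i j - a x j k * p i := by
    intro i j k
    rw [← haP i]
    simp only [hΓ, mul_sub, mul_add, sum_sub_distrib, sum_add_distrib, mul_sum]
    congr 1
    · simp [mul_comm]
    · exact sum_congr rfl fun l _ => by ring
  have hbP : ∑ l, b x l * P l = m := by
    have h1 : ∑ l, b x l * P l = ∑ i, bUp a b x i * p i := by
      have hb : ∀ l, b x l = ∑ i, a x l i * bUp a b x i := fun l =>
        (sum_mul_inv_mul hdet (b x) l).symm
      simp only [hb, ← haP, sum_mul, mul_sum]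
      rw [sum_comm]
      exact sum_congr rfl fun i _ => sum_congr rfl fun l _ => by rw [hax l i]; ring
    have h2 : ∑ i, bUp a b x i * p i
        = (m * ∑ i, bUp a b x i * b x i + ∑ i, bUp a b x i * sLow a b x i) / B := by
      rw [mul_sum, ← sum_add_distrib, sum_div]
      exact sum_congr rfl fun i _ => by simp only [hp]; ring
    rw [h1, h2, sum_bUp_mul_sLow, ← hB]
    field_simp
    ring
  refine ⟨fun i j => ?_, fun i => ?_⟩
  · rw [pd_metric_eq hdet hsymm, haΓ, haΓ, hax j i]
    ring
  · have hbΓ : ∑ l, b x l * christoffel a x l i k = p i * b x k + p k * b x i - a x i k * m := by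
      rw [← hbP]
      simp only [hΓ, mul_sub, mul_add, sum_sub_distrib, sum_add_distrib, mul_sum]
      congr 1
      · simp [mul_comm]
      · exact sum_congr rfl fun l _ => by ring
    have h1 := hr i k
    have h2 := hs i k
    unfold rTensor at h1
    unfold sTensor at h2
    have h3 : covDeriv a b x i k
        = m * a x i k + (b x i * sLow a b x k - b x k * sLow a b x i) / B := by linarith
    unfold covDeriv at h3
    rw [hbΓ] at h3
    have h4 : pd (fun z => b z i) x k = m * a x i k
        + (b x i * sLow a b x k - b x k * sLow a b x i) / B
        + (p i * b x k + p k * b x i - a x i k * m) := by linarith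
    rw [h4]
    simp only [hp]
    field_simp
    ring

/-- under the structure equations `r_{ij} = μ a_{ij}`,
`s_{ij} = (b_i s_j − b_j s_i)/b²` and
`Gⁱ_α = ρ₀ yⁱ − (μα²/(2b²)) bⁱ − (α²/(2b²)) sⁱ` with
`ρ₀ = Σ_j ((μ b_j + s_j)/b²) yʲ`, the deformed data `ã_{ij} = a_{ij}/b²`,
`b̃_i = b_i/b²` satisfy `b̃_{i|j} ≡ 0` and `G̃ⁱ ≡ 0` on `U`. -/
theorem kropina_deformation_flat_parallel
    {n : ℕ} (hn : 2 ≤ n) (U : Set (Fin n → ℝ)) (hU : IsOpen U)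
    (a : (Fin n → ℝ) → Matrix (Fin n) (Fin n) ℝ)
    (b : (Fin n → ℝ) → Fin n → ℝ)
    (ha_smooth : ∀ i j, ContDiffOn ℝ (⊤ : ℕ∞) (fun x => a x i j) U)
    (ha_symm : ∀ x ∈ U, (a x).IsSymm)
    (ha_pos : ∀ x ∈ U, (a x).PosDef)
    (hb_smooth : ∀ i, ContDiffOn ℝ (⊤ : ℕ∞) (fun x => b x i) U)
    (hb_ne : ∀ x ∈ U, b x ≠ 0)
    (hbsq : ∀ x ∈ U, 0 < ∑ i, bUp a b x i * b x i)
    (μ : (Fin n → ℝ) → ℝ) (hμ : ContDiffOn ℝ (⊤ : ℕ∞) μ U)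
    (hr : ∀ x ∈ U, ∀ i j, rTensor a b x i j = μ x * a x i j)
    (hs : ∀ x ∈ U, ∀ i j, sTensor a b x i j
      = (b x i * sLow a b x j - b x j * sLow a b x i) / (∑ i', bUp a b x i' * b x i'))
    (hG : ∀ x ∈ U, ∀ y : Fin n → ℝ, ∀ i,
      spray a x y i
        = (∑ j, ((μ x * b x j + sLow a b x j) / (∑ i', bUp a b x i' * b x i')) * y j) * y i
          - (μ x * (alphaFn a x y) ^ 2 / (2 * ∑ i', bUp a b x i' * b x i')) * bUp a b x i
          - ((alphaFn a x y) ^ 2 / (2 * ∑ i', bUp a b x i' * b x i')) * sUp a b x i)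
    (ta : (Fin n → ℝ) → Matrix (Fin n) (Fin n) ℝ)
    (tb : (Fin n → ℝ) → Fin n → ℝ)
    (hta : ∀ x i j, ta x i j = a x i j / (∑ i', bUp a b x i' * b x i'))
    (htb : ∀ x i, tb x i = b x i / (∑ i', bUp a b x i' * b x i')) :
    (∀ x ∈ U, ∀ i j, covDeriv ta tb x i j = 0) ∧
    (∀ x ∈ U, ∀ y : Fin n → ℝ, ∀ i, spray ta x y i = 0) := by
  have hzero : ∀ x ∈ U, (∀ i j k, pd (fun z => ta z i j) x k = 0) ∧
      ∀ i k, pd (fun z => tb z i) x k = 0 := by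
    intro x hx
    have hUx := hU.mem_nhds hx
    have ha : ∀ i j, DifferentiableAt ℝ (fun z => a z i j) x := fun i j =>
      ((ha_smooth i j).contDiffAt hUx).differentiableAt (by simp)
    have hb : ∀ i, DifferentiableAt ℝ (fun z => b z i) x := fun i =>
      ((hb_smooth i).contDiffAt hUx).differentiableAt (by simp)
    have hdet : (a x).det ≠ 0 := (ha_pos x hx).det_pos.ne'
    have hsymm : ∀ᶠ z in nhds x, (a z).IsSymm := Filter.mem_of_superset hUx ha_symm
    have hlog := pd_of_structure_eq hdet hsymm (ha_pos x hx).posSemidef rfl (hbsq x hx).ne'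
      (hr x hx) (hs x hx) (hG x hx)
    have hB := differentiableAt_normSq ha hdet hb
    have hBk := fun k => pd_normSq ha hdet hb (hlog k).1 (hlog k).2
    simp only [hta, htb]
    exact ⟨fun i j k => pd_div_eq_zero (ha i j) hB (hbsq x hx).ne' ((hlog k).1 i j) (hBk k),
      fun i k => pd_div_eq_zero (hb i) hB (hbsq x hx).ne' ((hlog k).2 i) (hBk k)⟩
  have hΓ : ∀ x ∈ U, ∀ l j k, christoffel ta x l j k = 0 := fun x hx l j k => by
    simp [christoffel, (hzero x hx).1]
  exact ⟨fun x hx i j => by simp [covDeriv, hΓ x hx, (hzero x hx).2],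
    fun x hx y i => by simp [spray, hΓ x hx]⟩
end
end

section
/- Let b > 0, m > 0 with m ≠ 1, and k be real constants such that 1 − k·t² > 0 for all t ∈ [0, b). Define φ : (0, b) → ℝ by φ(s) := m·b²·√(b² − s²)·∫₀ˢ (b² − t²)^{−3/2}·(t/√(1 − k·t²))^{m−1} dt (real powers). Then for every s ∈ (0, b), φ satisfies the identity s·(1 − k·s²)·(φ(s) − s·φ'(s) + (b² − s²)·φ''(s)) = (m − 1)·(s·φ(s) + (b² − s²)·φ'(s)). -/
noncomputable section

open Real

/-- `φ(s) = m·b²·√(b² − s²)·∫₀ˢ (b² − t²)^{−3/2}·(t/√(1 − kt²))^{m−1} dt`. -/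
def phi12 (b k m : ℝ) (s : ℝ) : ℝ :=
  m * b ^ 2 * Real.sqrt (b ^ 2 - s ^ 2) *
    ∫ t in (0 : ℝ)..s,
      (b ^ 2 - t ^ 2) ^ (-(3 / 2 : ℝ)) * (t / Real.sqrt (1 - k * t ^ 2)) ^ (m - 1)

/-- The weight `(t / √(1 - k t²))^(m-1)` solves `g' = (m-1) g / (t (1 - k t²))`. -/
theorem hasDerivAt_div_sqrt_rpow {k m s : ℝ} (hs : 0 < s) (hk : 0 < 1 - k * s ^ 2) :
    HasDerivAt (fun t : ℝ => (t / Real.sqrt (1 - k * t ^ 2)) ^ (m - 1))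
      ((m - 1) * (s / Real.sqrt (1 - k * s ^ 2)) ^ (m - 1) / (s * (1 - k * s ^ 2))) s := by
  have hr : 0 < Real.sqrt (1 - k * s ^ 2) := Real.sqrt_pos.2 hk
  have hq : 0 < s / Real.sqrt (1 - k * s ^ 2) := div_pos hs hr
  have hsq : Real.sqrt (1 - k * s ^ 2) ^ 2 = 1 - k * s ^ 2 := Real.sq_sqrt hk.le
  have hin : HasDerivAt (fun t : ℝ => 1 - k * t ^ 2) (-(k * (2 * s))) s := by
    simpa using ((hasDerivAt_pow 2 s).const_mul k).const_sub 1
  have h := ((hasDerivAt_id s).div (hin.sqrt hk.ne') hr.ne').rpow_const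
    (p := m - 1) (Or.inl hq.ne')
  refine h.congr_deriv ?_
  simp only [Pi.div_apply, id]
  rw [Real.rpow_sub_one hq.ne']
  generalize (s / Real.sqrt (1 - k * s ^ 2)) ^ (m - 1) = G
  generalize Real.sqrt (1 - k * s ^ 2) = R at *
  rw [← hsq]
  field_simp
  linear_combination (m - 1) * G * hsq

/-- The integrand defining `phi12` is continuous on `(0, b)`. -/
theorem continuousOn_phi12_integrand {b k m : ℝ}
    (hk : ∀ t ∈ Set.Ico (0 : ℝ) b, 0 < 1 - k * t ^ 2) :
    ContinuousOn (fun t : ℝ => (b ^ 2 - t ^ 2) ^ (-(3 / 2 : ℝ)) *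
      (t / Real.sqrt (1 - k * t ^ 2)) ^ (m - 1)) (Set.Ioo 0 b) := by
  intro t ht
  have hbt : 0 < b ^ 2 - t ^ 2 := by nlinarith [ht.1, ht.2]
  have hc : ContinuousAt (fun t : ℝ => (b ^ 2 - t ^ 2) ^ (-(3 / 2 : ℝ))) t :=
    ContinuousAt.rpow_const (by fun_prop) (Or.inl hbt.ne')
  exact (hc.mul (hasDerivAt_div_sqrt_rpow ht.1
    (hk t ⟨ht.1.le, ht.2⟩)).continuousAt).continuousWithinAt

/-- The integrand defining `phi12` is integrable up to the singular endpoint `0`. -/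
theorem intervalIntegrable_phi12_integrand {b k m s : ℝ} (hm : 0 < m)
    (hk : ∀ t ∈ Set.Ico (0 : ℝ) b, 0 < 1 - k * t ^ 2) (hs : s ∈ Set.Ioo 0 b) :
    IntervalIntegrable (fun t : ℝ => (b ^ 2 - t ^ 2) ^ (-(3 / 2 : ℝ)) *
      (t / Real.sqrt (1 - k * t ^ 2)) ^ (m - 1)) MeasureTheory.volume 0 s := by
  have hpow : IntervalIntegrable (fun t : ℝ => t ^ (m - 1)) MeasureTheory.volume 0 s :=
    intervalIntegral.intervalIntegrable_rpow' (by linarith)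
  have hc : ContinuousOn (fun t : ℝ => (b ^ 2 - t ^ 2) ^ (-(3 / 2 : ℝ)) *
      (Real.sqrt (1 - k * t ^ 2) ^ (m - 1))⁻¹) (Set.uIcc 0 s) := by
    rw [Set.uIcc_of_le hs.1.le]
    intro t ht
    have htb : t < b := ht.2.trans_lt hs.2
    have hbt : 0 < b ^ 2 - t ^ 2 := by nlinarith [ht.1]
    have hr := Real.sqrt_pos.2 (hk t ⟨ht.1, htb⟩)
    have h1 : ContinuousAt (fun t : ℝ => (b ^ 2 - t ^ 2) ^ (-(3 / 2 : ℝ))) t :=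
      ContinuousAt.rpow_const (by fun_prop) (Or.inl hbt.ne')
    have h2 : ContinuousAt (fun t : ℝ => Real.sqrt (1 - k * t ^ 2) ^ (m - 1)) t :=
      ContinuousAt.rpow_const (by fun_prop) (Or.inl hr.ne')
    exact (h1.mul (h2.inv₀ (Real.rpow_pos_of_pos hr _).ne')).continuousWithinAt
  refine (hpow.mul_continuousOn hc).congr ?_
  intro t ht
  rw [Set.uIoc_of_le hs.1.le] at ht
  simp only
  rw [Real.div_rpow ht.1.le (Real.sqrt_nonneg _)]
  ring

/-- First-order equation satisfied by `phi12`: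
`s φ + (b² - s²) φ' = m b² (s / √(1 - k s²))^(m-1)`. -/
theorem hasDerivAt_phi12 {b k m s : ℝ} (hm : 0 < m)
    (hk : ∀ t ∈ Set.Ico (0 : ℝ) b, 0 < 1 - k * t ^ 2) (hs : s ∈ Set.Ioo 0 b) :
    HasDerivAt (phi12 b k m)
      ((m * b ^ 2 * (s / Real.sqrt (1 - k * s ^ 2)) ^ (m - 1) - s * phi12 b k m s) /
        (b ^ 2 - s ^ 2)) s := by
  have hbs : 0 < b ^ 2 - s ^ 2 := by nlinarith [hs.1, hs.2]
  have hr : 0 < Real.sqrt (b ^ 2 - s ^ 2) := Real.sqrt_pos.2 hbs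
  have hsq : Real.sqrt (b ^ 2 - s ^ 2) ^ 2 = b ^ 2 - s ^ 2 := Real.sq_sqrt hbs.le
  have hcont := continuousOn_phi12_integrand (m := m) hk
  have hint := intervalIntegral.integral_hasDerivAt_right
    (intervalIntegrable_phi12_integrand hm hk hs)
    (hcont.stronglyMeasurableAtFilter isOpen_Ioo s hs)
    (hcont.continuousAt (isOpen_Ioo.mem_nhds hs))
  have hin : HasDerivAt (fun t : ℝ => b ^ 2 - t ^ 2) (-(2 * s)) s := by
    simpa using (hasDerivAt_pow 2 s).const_sub (b ^ 2)
  have hpow : (b ^ 2 - s ^ 2) ^ (-(3 / 2 : ℝ)) = (Real.sqrt (b ^ 2 - s ^ 2) ^ 3)⁻¹ := by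
    rw [Real.rpow_neg hbs.le, Real.sqrt_eq_rpow, ← Real.rpow_mul_natCast hbs.le]
    norm_num
  refine (((hin.sqrt hbs.ne').const_mul (m * b ^ 2)).mul hint).congr_deriv ?_
  simp only [phi12]
  rw [hpow]
  generalize (∫ t in (0 : ℝ)..s, (b ^ 2 - t ^ 2) ^ (-(3 / 2 : ℝ)) *
    (t / Real.sqrt (1 - k * t ^ 2)) ^ (m - 1)) = J
  generalize (s / Real.sqrt (1 - k * s ^ 2)) ^ (m - 1) = G
  generalize Real.sqrt (b ^ 2 - s ^ 2) = R at *
  rw [← hsq]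
  field_simp
  ring

/-- the integral formula `φ` of the fourth class satisfies the
classifying ODE `s(1 − ks²)(φ − sφ' + (b² − s²)φ'') = (m − 1)(sφ + (b² − s²)φ')`
on `(0, b)`. -/
theorem phi12_ode (b k m : ℝ) (hb : 0 < b) (hm : 0 < m) (hm1 : m ≠ 1)
    (hk : ∀ t ∈ Set.Ico (0 : ℝ) b, 0 < 1 - k * t ^ 2) :
    ∀ s ∈ Set.Ioo (0 : ℝ) b,
      s * (1 - k * s ^ 2) *
          (phi12 b k m s - s * deriv (phi12 b k m) s
            + (b ^ 2 - s ^ 2) * deriv (deriv (phi12 b k m)) s)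
        = (m - 1) * (s * phi12 b k m s + (b ^ 2 - s ^ 2) * deriv (phi12 b k m) s) := by
  intro s hs
  have hbs : 0 < b ^ 2 - s ^ 2 := by nlinarith [hs.1, hs.2]
  have hks := hk s ⟨hs.1.le, hs.2⟩
  have hφ := hasDerivAt_phi12 hm hk hs
  have hev : deriv (phi12 b k m) =ᶠ[nhds s] fun t =>
      (m * b ^ 2 * (t / Real.sqrt (1 - k * t ^ 2)) ^ (m - 1) - t * phi12 b k m t) /
        (b ^ 2 - t ^ 2) := by
    filter_upwards [isOpen_Ioo.mem_nhds hs] with t ht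
    exact (hasDerivAt_phi12 hm hk ht).deriv
  have hin : HasDerivAt (fun t : ℝ => b ^ 2 - t ^ 2) (-(2 * s)) s := by
    simpa using (hasDerivAt_pow 2 s).const_sub (b ^ 2)
  have hd := ((((hasDerivAt_div_sqrt_rpow (m := m) hs.1 hks).const_mul (m * b ^ 2)).sub
    ((hasDerivAt_id' s).mul hφ)).div hin hbs.ne').deriv
  have hd2 := hev.deriv_eq.trans hd
  simp only [Pi.sub_apply, Pi.mul_apply] at hd2
  rw [hd2, hφ.deriv]
  generalize phi12 b k m s = P
  generalize (s / Real.sqrt (1 - k * s ^ 2)) ^ (m - 1) = G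
  have hs0 := hs.1.ne'
  have hb0 := hbs.ne'
  have hk0 := hks.ne'
  generalize 1 - k * s ^ 2 = D at hk0 ⊢
  field_simp
  ring
end
end

section
/- Let b > 0 and k be real constants with k·b² ≠ 1, and let s ∈ (0, b) be such that 1 − k·t² > 0 for all t ∈ [0, s]. Then 4b²·√(b² − s²)·∫₀ˢ t³/((b² − t²)^{3/2}·(1 − k·t²)^{3/2}) dt = (4b²/(1 − k·b²)²)·(b·√(1 − k·s²) − √(b² − s²))²/√(1 − k·s²). -/
noncomputable section

open Real

theorem rpow_three_halves_eq_sqrt_pow {x : ℝ} (hx : 0 ≤ x) :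
    x ^ ((3 : ℝ) / 2) = Real.sqrt x ^ 3 := by
  rw [Real.sqrt_eq_rpow, ← Real.rpow_mul_natCast hx]
  norm_num

theorem hasDerivAt_sqrt_sub_mul_sq {c k t : ℝ} (h : 0 < c - k * t ^ 2) :
    HasDerivAt (fun t => Real.sqrt (c - k * t ^ 2)) (-(k * t) / Real.sqrt (c - k * t ^ 2)) t := by
  have h1 := ((((hasDerivAt_id' t).pow 2).const_mul k).const_sub c).sqrt h.ne'
  refine h1.congr_deriv ?_
  have hne := (Real.sqrt_pos.2 h).ne'
  simp only [Pi.pow_apply]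
  norm_num
  field_simp

theorem hasDerivAt_sq_sub_div_sqrt_mul_sqrt {b k t : ℝ} (hk : k * b ^ 2 ≠ 1)
    (h₁ : 0 < b ^ 2 - t ^ 2) (h₂ : 0 < 1 - k * t ^ 2) :
    HasDerivAt
      (fun t => (b * Real.sqrt (1 - k * t ^ 2) - Real.sqrt (b ^ 2 - t ^ 2)) ^ 2 /
        ((1 - k * b ^ 2) ^ 2 * (Real.sqrt (b ^ 2 - t ^ 2) * Real.sqrt (1 - k * t ^ 2))))
      (t ^ 3 / ((b ^ 2 - t ^ 2) ^ ((3 : ℝ) / 2) * (1 - k * t ^ 2) ^ ((3 : ℝ) / 2))) t := by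
  have hA : HasDerivAt (fun t => Real.sqrt (b ^ 2 - t ^ 2)) (-t / Real.sqrt (b ^ 2 - t ^ 2)) t := by
    simpa using hasDerivAt_sqrt_sub_mul_sq (c := b ^ 2) (k := 1) (t := t) (by simpa using h₁)
  have hC := hasDerivAt_sqrt_sub_mul_sq h₂
  have hA0 := (Real.sqrt_pos.2 h₁).ne'
  have hC0 := (Real.sqrt_pos.2 h₂).ne'
  have hA2 := Real.sq_sqrt h₁.le
  have hC2 := Real.sq_sqrt h₂.le
  have hD : 1 - k * b ^ 2 ≠ 0 := sub_ne_zero.2 hk.symm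
  rw [rpow_three_halves_eq_sqrt_pow h₁.le, rpow_three_halves_eq_sqrt_pow h₂.le]
  have hF := (((hC.const_mul b).sub hA).pow 2).div ((hA.mul hC).const_mul ((1 - k * b ^ 2) ^ 2))
    (mul_ne_zero (pow_ne_zero 2 hD) (mul_ne_zero hA0 hC0))
  refine hF.congr_deriv ?_
  simp only [Pi.sub_apply, Pi.mul_apply, Pi.pow_apply]
  generalize Real.sqrt (b ^ 2 - t ^ 2) = A at *
  generalize Real.sqrt (1 - k * t ^ 2) = C at *
  have hDeq : C ^ 2 - k * A ^ 2 = 1 - k * b ^ 2 := by rw [hA2, hC2]; ring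
  have ht : b ^ 2 * C ^ 2 - A ^ 2 = t ^ 2 * (1 - k * b ^ 2) := by rw [hA2, hC2]; ring
  generalize 1 - k * b ^ 2 = D at *
  field_simp
  have key : t * (C ^ 2 - k * A ^ 2) * (b ^ 2 * C ^ 2 - A ^ 2) = t ^ 3 * D ^ 2 := by
    rw [hDeq, ht]; ring
  norm_num
  linear_combination key

/-- `4b²√(b² − s²)·∫₀ˢ t³/((b² − t²)^{3/2}(1 − kt²)^{3/2}) dt
= (4b²/(1 − kb²)²)·(b√(1 − ks²) − √(b² − s²))²/√(1 − ks²)`. -/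
theorem integral_m_four (b k s : ℝ) (hb : 0 < b) (hk : k * b ^ 2 ≠ 1)
    (hs : s ∈ Set.Ioo (0 : ℝ) b)
    (hpos : ∀ t ∈ Set.Icc (0 : ℝ) s, 0 < 1 - k * t ^ 2) :
    4 * b ^ 2 * Real.sqrt (b ^ 2 - s ^ 2) *
        ∫ t in (0 : ℝ)..s,
          t ^ 3 / ((b ^ 2 - t ^ 2) ^ ((3 : ℝ) / 2) * (1 - k * t ^ 2) ^ ((3 : ℝ) / 2))
      = (4 * b ^ 2 / (1 - k * b ^ 2) ^ 2) *
          (b * Real.sqrt (1 - k * s ^ 2) - Real.sqrt (b ^ 2 - s ^ 2)) ^ 2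
            / Real.sqrt (1 - k * s ^ 2) := by
  obtain ⟨hs0, hsb⟩ := hs
  have hA : ∀ t ∈ Set.uIcc 0 s, 0 < b ^ 2 - t ^ 2 := by
    intro t ht
    rw [Set.uIcc_of_le hs0.le] at ht
    nlinarith [ht.1, ht.2]
  have hC : ∀ t ∈ Set.uIcc 0 s, 0 < 1 - k * t ^ 2 := by
    rwa [Set.uIcc_of_le hs0.le]
  have hcont : ContinuousOn
      (fun t : ℝ => t ^ 3 / ((b ^ 2 - t ^ 2) ^ ((3 : ℝ) / 2) * (1 - k * t ^ 2) ^ ((3 : ℝ) / 2)))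
      (Set.uIcc 0 s) := by
    refine ContinuousOn.div (by fun_prop) (ContinuousOn.mul ?_ ?_) fun t ht =>
      (mul_pos (Real.rpow_pos_of_pos (hA t ht) _) (Real.rpow_pos_of_pos (hC t ht) _)).ne'
    · exact ContinuousOn.rpow_const (by fun_prop) fun t ht => Or.inl (hA t ht).ne'
    · exact ContinuousOn.rpow_const (by fun_prop) fun t ht => Or.inl (hC t ht).ne'
  rw [intervalIntegral.integral_eq_sub_of_hasDerivAt
    (fun t ht => hasDerivAt_sq_sub_div_sqrt_mul_sqrt hk (hA t ht) (hC t ht))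
    hcont.intervalIntegrable]
  have hA0 := (Real.sqrt_pos.2 (hA s Set.right_mem_uIcc)).ne'
  have hC0 := (Real.sqrt_pos.2 (hC s Set.right_mem_uIcc)).ne'
  have hD : 1 - k * b ^ 2 ≠ 0 := sub_ne_zero.2 hk.symm
  have h0 : b * Real.sqrt (1 - k * 0 ^ 2) - Real.sqrt (b ^ 2 - 0 ^ 2) = 0 := by
    simp [Real.sqrt_sq hb.le]
  rw [h0, zero_pow two_ne_zero, zero_div, sub_zero]
  generalize Real.sqrt (b ^ 2 - s ^ 2) = A at *
  generalize Real.sqrt (1 - k * s ^ 2) = C at *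
  generalize 1 - k * b ^ 2 = D at *
  field_simp
end
end
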